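/- Let (X, τ) be a separable completely metrizable (Polish) topological space, and let μ be a topology on X² with the following properties: (i) μ is finer than the product topology τ² on X²; (ii) there are at most 2^ℵ₀ many μ-closed 2-uncountable subsets of X²; (iii) every μ-closed 2-uncountable set A ⊆ X² satisfies |A|₂ ≥ 2^ℵ₀. Then X contains a sequence B₁, B₂, … of pairwise disjoint subsets such that every B_i is weakly 2-Bernstein with respect to μ and, for every integer n ≥ 1, weakly n-Bernstein with respect to the product topology τⁿ on Xⁿ. -/

import Mathlib

open Cardinal Set Topology

universe u

/-- The `n`-cardinality `|A|ₙ` of a set `A ⊆ Xⁿ` with respect to `X`: the least cardinal `κ`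
such that there is `Y ⊆ X` with `#Y = κ` and every point of `A` has a coordinate in `Y`. -/
noncomputable def nCardinality {X : Type u} (n : ℕ) (A : Set (Fin n → X)) : Cardinal.{u} :=
  sInf {κ : Cardinal.{u} | ∃ Y : Set X, #Y = κ ∧ ∀ p ∈ A, ∃ i, p i ∈ Y}

/-- `B ⊆ X` is weakly `n`-Bernstein with respect to a topology `σ` on `Xⁿ` if
`|A ∩ Bⁿ|ₙ = 2^ℵ₀` for every `σ`-closed `n`-uncountable set `A ⊆ Xⁿ`. -/
def WeaklyBernstein {X : Type u} (n : ℕ) (σ : TopologicalSpace (Fin n → X))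
    (B : Set X) : Prop :=
  ∀ A : Set (Fin n → X), IsClosed[σ] A → aleph0 < nCardinality n A →
    nCardinality n (A ∩ {p | ∀ i, p i ∈ B}) = continuum

section NCardinality

variable {X : Type u} {n : ℕ} {A : Set (Fin n → X)}

theorem nCardinality_le_mk {Y : Set X} (h : ∀ p ∈ A, ∃ i, p i ∈ Y) : nCardinality n A ≤ #Y :=
  csInf_le' ⟨Y, rfl, h⟩

theorem ne_zero_of_nCardinality_pos (h : 0 < nCardinality n A) : n ≠ 0 := by
  rintro rfl
  refine h.ne' ?_
  rcases A.eq_empty_or_nonempty with rfl | ⟨p, hp⟩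
  · exact le_antisymm ((nCardinality_le_mk (Y := ∅) (by simp)).trans (by simp)) zero_le
  · refine (congrArg sInf (Set.eq_empty_of_forall_notMem ?_)).trans Cardinal.sInf_empty
    rintro κ ⟨Y, -, hY⟩
    exact (hY p hp).choose.elim0

theorem nCardinality_le_mk_univ (hn : n ≠ 0) : nCardinality n A ≤ #X :=
  (nCardinality_le_mk (Y := Set.univ) fun _ _ => ⟨⟨0, Nat.pos_of_ne_zero hn⟩, trivial⟩).trans
    (by simp)

/-- A family of points of `A` with pairwise disjoint sets of coordinates bounds the
`n`-cardinality of `A` from below. -/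
theorem mk_le_nCardinality {ι : Type u} (hn : n ≠ 0) (f : ι → Fin n → X) (hf : ∀ i, f i ∈ A)
    (hdisj : Pairwise fun i j => ∀ a b, f i a ≠ f j b) : #ι ≤ nCardinality n A := by
  refine le_csInf ⟨#(Set.univ : Set X), Set.univ, rfl,
    fun _ _ => ⟨⟨0, Nat.pos_of_ne_zero hn⟩, trivial⟩⟩ ?_
  rintro _ ⟨Y, rfl, hY⟩
  choose c hc using fun i => hY (f i) (hf i)
  refine Cardinal.mk_le_of_injective (f := fun i => (⟨f i (c i), hc i⟩ : Y)) fun i j hij => ?_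
  by_contra hne
  exact hdisj hne _ _ (congrArg Subtype.val hij)

/-- Given at most `κ` many sets, each of `n`-cardinality at least `κ` (where `n` may vary), one
can choose a point from each of them so that the chosen points have pairwise disjoint sets of
coordinates. -/
theorem exists_choice_disjoint_coords {κ : Cardinal.{u}} (hκ : ℵ₀ < κ) {ι : Type u}
    (hι : #ι ≤ κ) (N : ι → ℕ) (A : ∀ i, Set (Fin (N i) → X))
    (hA : ∀ i, κ ≤ nCardinality (N i) (A i)) :
    ∃ p : ∀ i, Fin (N i) → X, (∀ i, p i ∈ A i) ∧
      Pairwise fun i j => ∀ a b, p i a ≠ p j b := by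
  obtain ⟨r, hr, hord⟩ := Cardinal.exists_ord_eq ι
  have step : ∀ i (g : ∀ j, r j i → Fin (N j) → X),
      ∃ p ∈ A i, ∀ j (h : r j i) a b, p a ≠ g j h b := by
    intro i g
    by_contra! hcon
    let Y : Set X := ⋃ j : {j // r j i}, Set.range (g j.1 j.2)
    have hY : nCardinality (N i) (A i) ≤ #Y := nCardinality_le_mk fun p hp => by
      obtain ⟨j, h, a, b, hab⟩ := hcon p hp
      exact ⟨a, Set.mem_iUnion.2 ⟨⟨j, h⟩, b, hab.symm⟩⟩
    refine ((hA i).trans hY).not_gt ((Cardinal.mk_iUnion_le _).trans_lt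
      (Cardinal.mul_lt_of_lt hκ.le ?_ ?_))
    · exact (Cardinal.card_typein_lt (r := r) i hord).trans_le hι
    · refine lt_of_le_of_lt (ciSup_le' fun j => ?_) hκ
      exact (Set.countable_range _).le_aleph0
  choose F hFA hF using step
  let p : ∀ i, Fin (N i) → X := hr.wf.fix F
  have hp : ∀ i, p i = F i fun j _ => p j := fun i => hr.wf.fix_eq F i
  have key : ∀ i j, r j i → ∀ a b, p i a ≠ p j b := fun i j h a b => by
    rw [hp i]
    exact hF i (fun j _ => p j) j h a b
  refine ⟨p, fun i => by rw [hp i]; exact hFA _ _, fun i j hij a b => ?_⟩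
  rcases trichotomous_of r i j with h | h | h
  · exact (key j i h b a).symm
  · exact absurd h hij
  · exact key i j h a b

/-- Given at most continuum many sets of `n`-cardinality at least continuum (where `n` may vary),
there are disjoint sets `B₀, B₁, …` such that every given set meets the power of every `Bᵢ` in a
set of `n`-cardinality at least continuum. -/
theorem exists_disjoint_seq_continuum_le_nCardinality {ι : Type u} (hι : #ι ≤ continuum)
    (N : ι → ℕ) (A : ∀ i, Set (Fin (N i) → X))
    (hA : ∀ i, continuum ≤ nCardinality (N i) (A i)) :
    ∃ B : ℕ → Set X, Pairwise (Function.onFun Disjoint B) ∧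
      ∀ k i, continuum ≤ nCardinality (N i) (A i ∩ {p | ∀ a, p a ∈ B k}) := by
  let κ := (continuum.{u}).out
  have hcard : #(ι × ULift.{u} ℕ × κ) ≤ continuum := by
    simp only [Cardinal.mk_prod, Cardinal.lift_id, Cardinal.mk_uLift, Cardinal.mk_nat,
      Cardinal.lift_aleph0, κ, Cardinal.mk_out, Cardinal.aleph0_mul_continuum]
    exact (mul_le_mul_left hι _).trans Cardinal.continuum_mul_self.le
  obtain ⟨p, hpA, hp⟩ := exists_choice_disjoint_coords Cardinal.aleph0_lt_continuum hcard
    (fun x => N x.1) (fun x => A x.1) fun x => hA x.1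
  refine ⟨fun k => {y | ∃ i c a, p (i, ⟨k⟩, c) a = y}, fun k l hkl => ?_, fun k i => ?_⟩
  · refine Set.disjoint_left.2 ?_
    rintro _ ⟨i, c, a, rfl⟩ ⟨j, d, b, h⟩
    refine hp (i := (j, ⟨l⟩, d)) (j := (i, ⟨k⟩, c)) (fun h => hkl ?_) b a h
    simp only [Prod.mk.injEq, ULift.up.injEq] at h
    exact h.2.1.symm
  · have hn := ne_zero_of_nCardinality_pos (Cardinal.continuum_pos.trans_le (hA i))
    rw [← Cardinal.mk_out continuum.{u}]
    refine mk_le_nCardinality hn (fun c => p (i, ⟨k⟩, c))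
      (fun c => ⟨hpA (i, ⟨k⟩, c), fun a => ⟨i, c, a, rfl⟩⟩) fun c d hcd =>
        hp (i := (i, ⟨k⟩, c)) (j := (i, ⟨k⟩, d)) ?_
    simpa using hcd

end NCardinality

section OpenGraph

open CantorScheme PiNat Filter ENNReal

/-- An open symmetric relation on a complete metric space, for which every open set meeting `S`
contains two related points of `S`, admits a clique indexed by the Cantor space. -/
theorem exists_cantor_pairwise {Z : Type*} [MetricSpace Z] [CompleteSpace Z] {R : Z → Z → Prop}
    (hsymm : Std.Symm R) (hopen : IsOpen {q : Z × Z | R q.1 q.2})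
    {S : Set Z} (hS : S.Nonempty)
    (hsplit : ∀ U : Set Z, IsOpen U → (U ∩ S).Nonempty → ∃ x ∈ U ∩ S, ∃ y ∈ U ∩ S, R x y) :
    ∃ f : (ℕ → Bool) → Z, Pairwise fun a b => R (f a) (f b) := by
  let P (U : Set Z) : Prop := IsOpen U ∧ (U ∩ S).Nonempty
  obtain ⟨u, -, upos', hu⟩ := exists_seq_strictAnti_tendsto' (zero_lt_one' ℝ≥0∞)
  have split : ∀ (U : {U : Set Z // P U}) (n : ℕ), ∃ V : Bool → {U : Set Z // P U},
      (∀ b, closure (V b : Set Z) ⊆ U) ∧ (∀ b, Metric.ediam (V b : Set Z) ≤ u n) ∧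
      ∀ b c, b ≠ c → ∀ x ∈ (V b : Set Z), ∀ y ∈ (V c : Set Z), R x y := by
    rintro ⟨U, hUo, hUS⟩ n
    obtain ⟨x, ⟨hxU, hxS⟩, y, ⟨hyU, hyS⟩, hxy⟩ := hsplit U hUo hUS
    obtain ⟨s, t, hs, ht, hxs, hyt, hst⟩ := isOpen_prod_iff.1 hopen x y hxy
    have small : ∀ (z : Z) (W : Set Z), IsOpen W → z ∈ W → ∃ V : Set Z, IsOpen V ∧ z ∈ V ∧
        closure V ⊆ W ∧ Metric.ediam V ≤ u n := by
      intro z W hW hz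
      obtain ⟨V, hV, hVc, hVW⟩ := exists_mem_nhds_isClosed_subset (hW.mem_nhds hz)
      have hpos : 0 < u n / 2 := ENNReal.half_pos (upos' n).1.ne'
      refine ⟨interior V ∩ Metric.eball z (u n / 2), isOpen_interior.inter Metric.isOpen_eball,
        ⟨mem_interior_iff_mem_nhds.2 hV, Metric.mem_eball_self hpos⟩, ?_, ?_⟩
      · exact (closure_minimal (Set.inter_subset_left.trans interior_subset) hVc).trans hVW
      · refine (Metric.ediam_mono Set.inter_subset_right).trans
          (Metric.ediam_eball_le.trans (ENNReal.mul_div_cancel (by simp) (by simp)).le)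
    obtain ⟨V, hVo, hxV, hVU, hVd⟩ := small x (U ∩ s) (hUo.inter hs) ⟨hxU, hxs⟩
    obtain ⟨W, hWo, hyW, hWU, hWd⟩ := small y (U ∩ t) (hUo.inter ht) ⟨hyU, hyt⟩
    have hVW : ∀ a ∈ V, ∀ b ∈ W, R a b := fun a ha b hb =>
      hst (Set.mk_mem_prod (hVU (subset_closure ha)).2 (hWU (subset_closure hb)).2)
    refine ⟨fun b => cond b ⟨V, hVo, x, hxV, hxS⟩ ⟨W, hWo, y, hyW, hyS⟩, ?_, ?_, ?_⟩
    · rintro (_ | _)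
      exacts [hWU.trans Set.inter_subset_left, hVU.trans Set.inter_subset_left]
    · rintro (_ | _)
      exacts [hWd, hVd]
    · rintro (_ | _) (_ | _) hbc a ha b hb
      exacts [absurd rfl hbc, hsymm.symm _ _ (hVW b hb a ha), hVW a ha b hb, absurd rfl hbc]
  choose V hVU hVd hVR using split
  let D : List Bool → {U : Set Z // P U} := fun l =>
    l.rec ⟨Set.univ, isOpen_univ, by simpa using hS⟩ fun b l U => V U l.length b
  let E : List Bool → Set Z := fun l => (D l).1
  have hanti : ClosureAntitone E := fun l b => hVU (D l) l.length b
  have hdiam : VanishingDiam E := fun x => by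
    rw [← tendsto_add_atTop_iff_nat 1]
    refine tendsto_of_tendsto_of_tendsto_of_le_of_le tendsto_const_nhds hu
      (fun _ => zero_le) fun m => ?_
    exact (hVd (D (res x m)) (res x m).length (x m)).trans_eq (by rw [res_length])
  have hdom : ∀ x : ℕ → Bool, x ∈ (inducedMap E).1 := fun x => by
    rw [hanti.map_of_vanishingDiam hdiam fun l => (D l).2.2.mono Set.inter_subset_left]
    trivial
  have hmem : ∀ x n, (inducedMap E).2 ⟨x, hdom x⟩ ∈ E (res x n) :=
    fun x n => map_mem (A := E) ⟨x, hdom x⟩ n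
  refine ⟨fun x => (inducedMap E).2 ⟨x, hdom x⟩, fun x y hxy => ?_⟩
  have hne := Function.ne_iff.1 hxy
  classical
  have hx := hmem x (Nat.find hne + 1)
  have hy := hmem y (Nat.find hne + 1)
  have hres : res x (Nat.find hne) = res y (Nat.find hne) :=
    res_eq_res.2 fun m hm => not_not.1 (Nat.find_min hne hm)
  rw [res_succ] at hx hy
  rw [← hres] at hy
  exact hVR _ _ _ _ (Nat.find_spec hne) _ hx _ hy

/-- In a second countable space, all but countably many points of a set are condensation points
of it. -/
theorem countable_setOf_exists_nhds_inter_countable {Z : Type*} [TopologicalSpace Z]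
    [SecondCountableTopology Z] (S : Set Z) :
    {x ∈ S | ∃ U ∈ 𝓝 x, (U ∩ S).Countable}.Countable := by
  let b := TopologicalSpace.countableBasis Z
  refine Set.Countable.mono (s₂ := ⋃ U ∈ {U ∈ b | (U ∩ S).Countable}, U ∩ S) ?_ ?_
  · rintro x ⟨hxS, U, hU, hUS⟩
    obtain ⟨V, hVb, hxV, hVU⟩ :=
      (TopologicalSpace.isBasis_countableBasis Z).mem_nhds_iff.1 hU
    exact Set.mem_biUnion (x := V) ⟨hVb, hUS.mono (Set.inter_subset_inter_left _ hVU)⟩ ⟨hxV, hxS⟩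
  · exact ((TopologicalSpace.countable_countableBasis Z).mono fun _ h => h.1).biUnion
      fun _ h => h.2

/-- An open symmetric relation on a Polish space with an uncountable clique has a clique indexed
by the Cantor space. -/
theorem exists_cantor_pairwise_of_not_countable {Z : Type*} [TopologicalSpace Z] [PolishSpace Z]
    {R : Z → Z → Prop} (hsymm : Std.Symm R) (hopen : IsOpen {q : Z × Z | R q.1 q.2}) {S : Set Z}
    (hS : ¬S.Countable) (hR : S.Pairwise R) :
    ∃ f : (ℕ → Bool) → Z, Pairwise fun a b => R (f a) (f b) := by
  let := TopologicalSpace.upgradeIsCompletelyMetrizable Z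
  let T : Set Z := {x ∈ S | ∃ U ∈ 𝓝 x, (U ∩ S).Countable}
  have hT : T.Countable := countable_setOf_exists_nhds_inter_countable S
  refine exists_cantor_pairwise hsymm hopen (S := S \ T) ?_ ?_
  · by_contra h
    exact hS (hT.mono (Set.sdiff_eq_empty.1 (Set.not_nonempty_iff_eq_empty.1 h)))
  · rintro U hU ⟨x, hxU, hxS, hxT⟩
    have hUS : ¬(U ∩ S).Countable := fun h => hxT ⟨hxS, U, hU.mem_nhds hxU, h⟩
    have hnt : (U ∩ (S \ T)).Nontrivial := by
      by_contra h
      refine hUS (((Set.not_nontrivial_iff.1 h).countable.union hT).mono fun y hy => ?_)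
      by_cases hyT : y ∈ T
      exacts [Or.inr hyT, Or.inl ⟨hy.1, hy.2, hyT⟩]
    obtain ⟨y, hy, z, hz, hyz⟩ := hnt
    exact ⟨y, hy, z, hz, hR hy.2.1 hz.2.1 hyz⟩

end OpenGraph

/-- In a Polish space, every `n`-uncountable closed subset of the `n`-th power has `n`-cardinality
at least continuum. -/
theorem IsClosed.continuum_le_nCardinality {X : Type u} [TopologicalSpace X] [PolishSpace X]
    {n : ℕ} {A : Set (Fin n → X)} (hA : IsClosed A) (h : ℵ₀ < nCardinality n A) :
    continuum ≤ nCardinality n A := by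
  have hn := ne_zero_of_nCardinality_pos (Cardinal.aleph0_pos.trans h)
  let a₀ : Fin n := ⟨0, Nat.pos_of_ne_zero hn⟩
  let ι := (Order.succ (ℵ₀ : Cardinal.{u})).out
  have hι : #ι = Order.succ ℵ₀ := Cardinal.mk_out _
  obtain ⟨p, hpA, hp⟩ := exists_choice_disjoint_coords (Order.lt_succ ℵ₀) hι.le
    (fun _ => n) (fun _ => A) fun _ => Order.succ_le_of_lt h
  let q : ι → A := fun i => ⟨p i, hpA i⟩
  have hq : Function.Injective q := fun i j hij => by
    by_contra hne
    exact hp hne a₀ a₀ (congrFun (congrArg Subtype.val hij) a₀)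
  have : PolishSpace A := hA.polishSpace
  have hopen : IsOpen {z : A × A | ∀ a b, z.1.1 a ≠ z.2.1 b} := by
    simp only [Set.ofPred_forall]
    exact isOpen_iInter_of_finite fun a => isOpen_iInter_of_finite fun b =>
      isOpen_ne_fun ((continuous_apply a).comp (continuous_subtype_val.comp continuous_fst))
        ((continuous_apply b).comp (continuous_subtype_val.comp continuous_snd))
  have hunc : ¬(Set.range q).Countable := by
    rw [← Cardinal.le_aleph0_iff_set_countable, Cardinal.mk_range_eq _ hq, hι, not_le]
    exact Order.lt_succ _
  have hpair : (Set.range q).Pairwise fun x y => ∀ a b, x.1 a ≠ y.1 b := by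
    rintro _ ⟨i, rfl⟩ _ ⟨j, rfl⟩ hij
    exact hp fun h => hij (congrArg q h)
  obtain ⟨f, hf⟩ := exists_cantor_pairwise_of_not_countable
    ⟨fun _ _ h a b => (h b a).symm⟩ hopen hunc hpair
  have := mk_le_nCardinality (A := A) hn (fun x : ULift.{u} (ℕ → Bool) => (f x.down).1)
    (fun x => (f x.down).2) fun x y hxy => hf fun h => hxy (ULift.down_injective h)
  simpa using this

/-- A second countable space has at most continuum many closed sets. -/
theorem mk_isClosed_le_continuum (Z : Type u) [TopologicalSpace Z] [SecondCountableTopology Z] :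
    #{A : Set Z // IsClosed A} ≤ continuum := by
  have hb := TopologicalSpace.isBasis_countableBasis Z
  let g : {A : Set Z // IsClosed A} → Set (TopologicalSpace.countableBasis Z) :=
    fun A => {V | Disjoint V.1 A.1}
  have hg : Function.Injective g := by
    have key : ∀ A B : {A : Set Z // IsClosed A}, g A = g B → B.1 ⊆ A.1 := by
      intro A B hAB x hx
      by_contra hxA
      obtain ⟨V, hV, hxV, hVA⟩ := hb.exists_subset_of_mem_open hxA A.2.isOpen_compl
      have hVg : (⟨V, hV⟩ : TopologicalSpace.countableBasis Z) ∈ g A :=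
        Set.disjoint_left.2 fun _ h => hVA h
      rw [hAB] at hVg
      exact Set.disjoint_left.1 hVg hxV hx
    exact fun A B h => Subtype.ext ((key B A h.symm).antisymm (key A B h))
  refine (Cardinal.mk_le_of_injective hg).trans ?_
  rw [Cardinal.mk_set, ← Cardinal.two_power_aleph0]
  exact Cardinal.power_le_power_left two_ne_zero
    (TopologicalSpace.countable_countableBasis Z).le_aleph0

theorem mk_le_continuum_of_secondCountable (Z : Type u) [TopologicalSpace Z] [T1Space Z]
    [SecondCountableTopology Z] : #Z ≤ continuum :=
  (Cardinal.mk_le_of_injective (f := fun z => (⟨{z}, isClosed_singleton⟩ : {A // IsClosed A}))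
    fun _ _ h => Set.singleton_injective (congrArg Subtype.val h)).trans
    (mk_isClosed_le_continuum Z)

/-- Theorem 1: if `X` is Polish and `μ` is a topology on `X²` finer than the product topology,
with at most continuum many `μ`-closed 2-uncountable sets, each of 2-cardinality at least
continuum, then `X` contains pairwise disjoint sets `B₁, B₂, …` each of which is weakly
2-Bernstein with respect to `μ` and weakly `n`-Bernstein with respect to the product topology
for every `n ≥ 1`. -/
theorem exists_weaklyBernstein_family {X : Type u} [TopologicalSpace X] [PolishSpace X]
    (μ : TopologicalSpace (Fin 2 → X)) (hfiner : μ ≤ Pi.topologicalSpace)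
    (hcount : #{A : Set (Fin 2 → X) // IsClosed[μ] A ∧ aleph0 < nCardinality 2 A} ≤ continuum)
    (hbig : ∀ A : Set (Fin 2 → X), IsClosed[μ] A → aleph0 < nCardinality 2 A →
      continuum ≤ nCardinality 2 A) :
    ∃ B : ℕ → Set X, Pairwise (Function.onFun Disjoint B) ∧
      ∀ i : ℕ, WeaklyBernstein 2 μ (B i) ∧
        ∀ n : ℕ, 1 ≤ n → WeaklyBernstein n Pi.topologicalSpace (B i) := by
  let F := {A : Set (Fin 2 → X) // IsClosed[μ] A ∧ ℵ₀ < nCardinality 2 A} ⊕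
    Σ n : ULift.{u} ℕ, {A : Set (Fin n.down → X) // IsClosed A ∧ ℵ₀ < nCardinality n.down A}
  have hF : #F ≤ continuum := by
    simp only [F, Cardinal.mk_sum, Cardinal.lift_id, Cardinal.mk_sigma]
    refine (add_le_add hcount ((Cardinal.sum_le_sum _ (fun _ => continuum) fun n => ?_).trans
      ?_)).trans Cardinal.continuum_add_self.le
    · exact (Cardinal.mk_le_of_injective (Set.inclusion_injective
        fun A (hA : IsClosed A ∧ ℵ₀ < nCardinality n.down A) => hA.1)).trans
        (mk_isClosed_le_continuum _)
    · simp
  obtain ⟨B, hB, hcont⟩ := exists_disjoint_seq_continuum_le_nCardinality hF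
    (Sum.elim (fun _ => 2) fun x => x.1.down)
    (fun i => match i with
      | .inl A => A.1
      | .inr x => x.2.1)
    (by
      rintro (A | ⟨n, A⟩)
      · exact hbig A.1 A.2.1 A.2.2
      · exact A.2.1.continuum_le_nCardinality A.2.2)
  have hX := mk_le_continuum_of_secondCountable X
  refine ⟨B, hB, fun i => ⟨fun A hA h => le_antisymm ?_ (hcont i (.inl ⟨A, hA, h⟩)),
    fun n hn A hA h => le_antisymm ?_ (hcont i (.inr ⟨⟨n⟩, A, hA, h⟩))⟩⟩
  · exact (nCardinality_le_mk_univ two_ne_zero).trans hX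
  · exact (nCardinality_le_mk_univ (Nat.one_le_iff_ne_zero.1 hn)).trans hX
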